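/- Let ℓ ∈ ℕ. Then every Λ ⊆ ℤ with d̄(Λ) > 0 contains a configuration {m, m+[n·log n], m+2[n·log n], …, m+ℓ[n·log n]} for some m ∈ ℤ and n ∈ ℕ with [n·log n] ≠ 0. -/

import Mathlib

open Filter

/-- The upper density of a set of integers. -/
noncomputable def upperDensity (Λ : Set ℤ) : ℝ :=
  Filter.limsup
    (fun N : ℕ => (Nat.card ↥(Λ ∩ Set.Icc (-(N : ℤ)) (N : ℤ)) : ℝ) / (2 * N + 1))
    Filter.atTop


namespace NLog

/-! ### Averages over finite types -/

/-- Uniform average of a real function over a finite type. -/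
noncomputable def EE {X : Type*} [Finite X] (f : X → ℝ) : ℝ :=
  letI := Fintype.ofFinite X
  (∑ x, f x) / (Nat.card X : ℝ)

/-- Indicator of a proposition. -/
noncomputable def ind (p : Prop) : ℝ := by
  classical exact if p then 1 else 0

lemma ind_true {p : Prop} (h : p) : ind p = 1 := by simp [ind, h]
lemma ind_false {p : Prop} (h : ¬ p) : ind p = 0 := by simp [ind, h]
lemma ind_nonneg (p : Prop) : 0 ≤ ind p := by
  by_cases h : p <;> simp [ind, h]
lemma ind_le_one (p : Prop) : ind p ≤ 1 := by
  by_cases h : p <;> simp [ind, h]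
lemma ind_mono {p q : Prop} (h : p → q) : ind p ≤ ind q := by
  by_cases hp : p
  · rw [ind_true hp, ind_true (h hp)]
  · rw [ind_false hp]; exact ind_nonneg q
lemma ind_and (p q : Prop) : ind (p ∧ q) = ind p * ind q := by
  by_cases hp : p <;> by_cases hq : q <;> simp [ind, hp, hq]
lemma of_ind_pos {p : Prop} (h : 0 < ind p) : p := by
  by_contra hp
  rw [ind_false hp] at h
  exact lt_irrefl _ h

section
variable {X Y : Type*} [Finite X] [Finite Y]

lemma EE_eq [Fintype X] (f : X → ℝ) : EE f = (∑ x, f x) / (Nat.card X : ℝ) := by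
  unfold EE
  congr 1
  apply Finset.sum_congr
  · ext; simp
  · intros; rfl

lemma EE_mono {f g : X → ℝ} (h : ∀ x, f x ≤ g x) : EE f ≤ EE g := by
  cases nonempty_fintype X
  rw [EE_eq, EE_eq]
  gcongr with x
  exact h x

lemma EE_congr {f g : X → ℝ} (h : ∀ x, f x = g x) : EE f = EE g := by
  rw [funext h]

lemma EE_add (f g : X → ℝ) : EE (fun x => f x + g x) = EE f + EE g := by
  cases nonempty_fintype X
  rw [EE_eq, EE_eq, EE_eq, Finset.sum_add_distrib, add_div]

lemma EE_sub (f g : X → ℝ) : EE (fun x => f x - g x) = EE f - EE g := by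
  cases nonempty_fintype X
  rw [EE_eq, EE_eq, EE_eq, Finset.sum_sub_distrib, sub_div]

lemma EE_mul_left (c : ℝ) (f : X → ℝ) : EE (fun x => c * f x) = c * EE f := by
  cases nonempty_fintype X
  rw [EE_eq, EE_eq, ← Finset.mul_sum, mul_div_assoc]

lemma EE_mul_right (c : ℝ) (f : X → ℝ) : EE (fun x => f x * c) = EE f * c := by
  rw [mul_comm, ← EE_mul_left]
  exact EE_congr fun x => mul_comm _ _

lemma EE_sum {L : Type*} (s : Finset L) (f : L → X → ℝ) :
    EE (fun x => ∑ l ∈ s, f l x) = ∑ l ∈ s, EE (f l) := by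
  cases nonempty_fintype X
  simp only [EE_eq]
  rw [Finset.sum_comm, Finset.sum_div]

lemma EE_const [Nonempty X] (c : ℝ) : EE (fun _ : X => c) = c := by
  cases nonempty_fintype X
  have : (Fintype.card X : ℝ) ≠ 0 := by
    exact_mod_cast Fintype.card_ne_zero
  rw [EE_eq]
  simp

lemma EE_le [Nonempty X] {f : X → ℝ} {c : ℝ} (h : ∀ x, f x ≤ c) : EE f ≤ c := by
  rw [← EE_const (X := X) c]; exact EE_mono h

lemma le_EE [Nonempty X] {f : X → ℝ} {c : ℝ} (h : ∀ x, c ≤ f x) : c ≤ EE f := by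
  rw [← EE_const (X := X) c]; exact EE_mono h

lemma EE_nonneg {f : X → ℝ} (h : ∀ x, 0 ≤ f x) : 0 ≤ EE f := by
  cases nonempty_fintype X
  rw [EE_eq]
  exact div_nonneg (Finset.sum_nonneg fun x _ => h x) (Nat.cast_nonneg _)

lemma exists_EE_le [Nonempty X] (f : X → ℝ) : ∃ x, EE f ≤ f x := by
  by_contra! h
  cases nonempty_fintype X
  obtain ⟨m, hm⟩ := Finite.exists_max f
  exact absurd (EE_le hm) (not_le.2 (h m))

lemma EE_equiv (e : X ≃ Y) (f : Y → ℝ) : EE (fun x => f (e x)) = EE f := by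
  cases nonempty_fintype X
  cases nonempty_fintype Y
  rw [EE_eq, EE_eq, Nat.card_congr e, Equiv.sum_comp e]

lemma EE_prod (f : X → Y → ℝ) : EE (fun p : X × Y => f p.1 p.2) = EE fun x => EE fun y => f x y := by
  cases nonempty_fintype X
  cases nonempty_fintype Y
  simp only [EE_eq]
  rw [Fintype.sum_prod_type, Nat.card_prod, ← Finset.sum_div, div_div]
  push_cast
  rw [mul_comm]

lemma EE_comm (f : X → Y → ℝ) : (EE fun x => EE fun y => f x y) = EE fun y => EE fun x => f x y := by
  rw [← EE_prod f, ← EE_prod fun y x => f x y]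
  exact EE_equiv (Equiv.prodComm X Y) (fun p : Y × X => f p.2 p.1)

/-- A lower bound for the average of a nonnegative function by one value. -/
lemma single_le_EE {f : X → ℝ} (h : ∀ x, 0 ≤ f x) (x : X) : f x / (Nat.card X : ℝ) ≤ EE f := by
  cases nonempty_fintype X
  rw [EE_eq]
  gcongr
  exact Finset.single_le_sum (fun i _ => h i) (Finset.mem_univ x)

/-- If a function is bounded above by `c` and its average is nearly `c`, it is nearly `c`. -/
lemma le_of_EE_ge {f : X → ℝ} {c t : ℝ} (h : ∀ x, f x ≤ c) (ht : c - t ≤ EE f) (x : X) :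
    c - t * (Nat.card X : ℝ) ≤ f x := by
  have : Nonempty X := ⟨x⟩
  have h1 := single_le_EE (f := fun x => c - f x) (fun x => by linarith [h x]) x
  rw [EE_sub, EE_const] at h1
  have hc : (0 : ℝ) < Nat.card X := by exact_mod_cast Nat.card_pos
  rw [div_le_iff₀ hc] at h1
  nlinarith

/-- Popularity principle. -/
lemma pop [Nonempty Y] {L : Type*} [Finite L] {g : Y → ℝ} {τ : ℝ} (hτ : 0 < τ)
    (hg : ∀ y, g y ≤ 1) (hE : 2 * τ ≤ EE g) (R : Y → L → Prop)
    (hR : ∀ y, τ ≤ g y → ∃ l, R y l) : ∃ l, τ / (Nat.card L : ℝ) ≤ EE fun y => ind (R y l) := by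
  cases nonempty_fintype L
  have h1 : EE g ≤ EE fun y => τ + ∑ l : L, ind (R y l) := by
    apply EE_mono
    intro y
    by_cases h : τ ≤ g y
    · obtain ⟨l, hl⟩ := hR y h
      have : ind (R y l) ≤ ∑ l : L, ind (R y l) :=
        Finset.single_le_sum (f := fun l => ind (R y l)) (fun i _ => ind_nonneg _)
          (Finset.mem_univ l)
      rw [ind_true hl] at this
      linarith [hg y]
    · have : 0 ≤ ∑ l : L, ind (R y l) := Finset.sum_nonneg fun i _ => ind_nonneg _
      linarith
  rw [EE_add, EE_const, EE_sum] at h1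
  have h2 : τ ≤ ∑ l : L, EE fun y => ind (R y l) := by linarith
  by_contra! h
  rcases isEmpty_or_nonempty L with hL | hL
  · simp at h2; linarith
  have h3 : ∑ l : L, EE (fun y => ind (R y l)) < ∑ l : L, τ / (Nat.card L : ℝ) :=
    Finset.sum_lt_sum_of_nonempty Finset.univ_nonempty fun l _ => h l
  have hc : (Fintype.card L : ℝ) ≠ 0 := by exact_mod_cast Fintype.card_ne_zero
  simp at h3
  rw [mul_div_cancel₀ _ hc] at h3
  linarith

end

/-- Fubini for words on a disjoint union of coordinate sets. -/
lemma EE_sumType {ι κ γ : Type*} [Finite ι] [Finite κ] [Finite γ] (f : (ι ⊕ κ → γ) → ℝ) :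
    EE f = EE fun x : ι → γ => EE fun y : κ → γ => f (Sum.elim x y) := by
  rw [← EE_prod fun (x : ι → γ) (y : κ → γ) => f (Sum.elim x y)]
  rw [← EE_equiv (Equiv.sumArrowEquivProdArrow ι κ γ).symm f]
  rfl

/-- Marginals of the uniform measure on a power. -/
lemma EE_marginal {ι X : Type*} [Finite ι] [Finite X] [Nonempty X] (i : ι) (g : X → ℝ) :
    EE (fun x : ι → X => g (x i)) = EE g := by
  classical
  have h := EE_equiv (Equiv.funSplitAt i X) (fun p => g p.1)
  have h2 := EE_prod fun (x : X) (_ : {j // j ≠ i} → X) => g x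
  rw [h2] at h
  simp only [EE_const] at h
  rw [← h]
  rfl

/-! ### Words, subspaces, lines -/

/-- Substitution of a word into a parameter word. -/
def sub {ι η γ : Type*} (V : ι → γ ⊕ η) (x : η → γ) : ι → γ := fun i => Sum.elim id x (V i)

/-- Composition of parameter words. -/
def comp {ι η ζ γ : Type*} (V : ι → γ ⊕ η) (U : η → γ ⊕ ζ) : ι → γ ⊕ ζ :=
  fun i => Sum.elim Sum.inl U (V i)

/-- All parameters occur. -/
def Proper {ι η γ : Type*} (V : ι → γ ⊕ η) : Prop := ∀ e, ∃ i, V i = Sum.inr e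

lemma sub_comp {ι η ζ γ : Type*} (V : ι → γ ⊕ η) (U : η → γ ⊕ ζ) (x : ζ → γ) :
    sub (comp V U) x = sub V (sub U x) := by
  funext i
  simp only [sub, comp]
  cases V i <;> rfl

lemma Proper.comp {ι η ζ γ : Type*} {V : ι → γ ⊕ η} {U : η → γ ⊕ ζ} (hV : Proper V)
    (hU : Proper U) : Proper (comp V U) := by
  intro e
  obtain ⟨j, hj⟩ := hU e
  obtain ⟨i, hi⟩ := hV j
  exact ⟨i, by simp [NLog.comp, hi, hj]⟩

lemma Proper.injective {ι η γ : Type*} {V : ι → γ ⊕ η} (hV : Proper V) :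
    Function.Injective (sub V) := by
  intro x y h
  funext e
  obtain ⟨i, hi⟩ := hV e
  have := congrFun h i
  simpa [sub, hi] using this

/-- The set `A` contains a combinatorial line. -/
def HasLine {ι γ : Type*} (A : (ι → γ) → Prop) : Prop :=
  ∃ L : ι → Option γ, (∃ i, L i = none) ∧ ∀ a, A (fun i => (L i).getD a)

lemma HasLine.of_sub {ι η γ : Type*} {A : (ι → γ) → Prop} {V : ι → γ ⊕ η} (hV : Proper V)
    (h : HasLine fun x => A (sub V x)) : HasLine A := by
  obtain ⟨L, ⟨e, he⟩, hL⟩ := h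
  refine ⟨fun i => Sum.elim some L (V i), ?_, fun a => ?_⟩
  · obtain ⟨i, hi⟩ := hV e
    exact ⟨i, by simp [hi, he]⟩
  · convert hL a using 1
    funext i
    simp only [sub]
    cases V i <;> rfl

/-- The density Hales-Jewett property of an alphabet. -/
def DHJ (γ : Type) [Finite γ] : Prop := ∀ δ : ℝ, 0 < δ → ∃ (ι : Type) (_ : Finite ι),
  ∀ A : (ι → γ) → Prop, δ ≤ EE (fun x => ind (A x)) → HasLine A

/-- Padding a parameter word on the left factor by a fixed word on the right factor. -/
def padR {ι κ η γ : Type*} (V : ι → γ ⊕ η) (y : κ → γ) : ι ⊕ κ → γ ⊕ η :=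
  Sum.elim V (fun j => Sum.inl (y j))

/-- Padding a parameter word on the right factor by a fixed word on the left factor. -/
def padL {ι κ η γ : Type*} (x : ι → γ) (V : κ → γ ⊕ η) : ι ⊕ κ → γ ⊕ η :=
  Sum.elim (fun j => Sum.inl (x j)) V

lemma sub_padR {ι κ η γ : Type*} (V : ι → γ ⊕ η) (y : κ → γ) (x : η → γ) :
    sub (padR V y) x = Sum.elim (sub V x) y := by
  funext i; cases i <;> rfl

lemma sub_padL {ι κ η γ : Type*} (y : ι → γ) (V : κ → γ ⊕ η) (x : η → γ) :
    sub (padL y V) x = Sum.elim y (sub V x) := by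
  funext i; cases i <;> rfl

lemma Proper.padR {ι κ η γ : Type*} {V : ι → γ ⊕ η} (hV : Proper V) (y : κ → γ) :
    Proper (padR V y) := fun e => by
  obtain ⟨i, hi⟩ := hV e
  exact ⟨Sum.inl i, hi⟩

lemma Proper.padL {ι κ η γ : Type*} {V : κ → γ ⊕ η} (hV : Proper V) (y : ι → γ) :
    Proper (padL y V) := fun e => by
  obtain ⟨i, hi⟩ := hV e
  exact ⟨Sum.inr i, hi⟩

/-- Multidimensional density Hales-Jewett from density Hales-Jewett. -/
lemma MDHJ {γ : Type} [Finite γ] [Nonempty γ] (H : DHJ γ) (η : Type) [Finite η] :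
    ∀ δ : ℝ, 0 < δ → ∃ (ι : Type) (_ : Finite ι), ∀ A : (ι → γ) → Prop,
      δ ≤ EE (fun x => ind (A x)) → ∃ V : ι → γ ⊕ η, Proper V ∧ ∀ x, A (sub V x) := by
  induction η using Finite.induction_empty_option with
  | of_equiv e IH =>
    intro δ hδ
    obtain ⟨ι, hι, h⟩ := IH δ hδ
    refine ⟨ι, hι, fun A hA => ?_⟩
    obtain ⟨V, hV, hVA⟩ := h A hA
    refine ⟨fun i => Sum.map id e (V i), fun f => ?_, fun x => ?_⟩
    · obtain ⟨i, hi⟩ := hV (e.symm f)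
      exact ⟨i, by simp [hi]⟩
    · convert hVA (fun f => x (e f)) using 1
      funext i
      simp only [sub]
      cases V i <;> rfl
  | h_empty =>
    intro δ hδ
    refine ⟨PEmpty, inferInstance, fun A hA => ?_⟩
    obtain ⟨x, hx⟩ := exists_EE_le (fun x => ind (A x))
    refine ⟨fun i => i.elim, fun e => e.elim, fun y => ?_⟩
    have : A x := of_ind_pos (by linarith)
    convert this using 1
    funext i
    exact i.elim
  | @h_option η _ IH =>
    intro δ hδ
    obtain ⟨ι₁, hι₁, h₁⟩ := H (δ / 2) (by positivity)
    have hLpos : (0 : ℝ) < Nat.card (ι₁ → Option γ) := by exact_mod_cast Nat.card_pos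
    obtain ⟨ι₂, hι₂, h₂⟩ := IH (δ / 2 / (Nat.card (ι₁ → Option γ) : ℝ)) (by positivity)
    refine ⟨ι₁ ⊕ ι₂, inferInstance, fun A hA => ?_⟩
    rw [EE_sumType, EE_comm] at hA
    obtain ⟨L, hL⟩ := pop (L := ι₁ → Option γ) (τ := δ / 2) (by positivity)
      (g := fun y : ι₂ → γ => EE fun x : ι₁ → γ => ind (A (Sum.elim x y)))
      (fun y => EE_le fun x => ind_le_one _) (by linarith)
      (fun y L => (∃ i, L i = none) ∧ ∀ a, A (Sum.elim (fun i => (L i).getD a) y))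
      (fun y hy => h₁ _ hy)
    obtain ⟨V, hV, hVA⟩ := h₂ _ hL
    refine ⟨Sum.elim (fun i => (L i).elim (Sum.inr none) Sum.inl)
      (fun j => Sum.map id some (V j)), fun e => ?_, fun x => ?_⟩
    · cases e with
      | none =>
        obtain ⟨i, hi⟩ := (hVA (fun _ => Classical.arbitrary γ)).1
        exact ⟨Sum.inl i, by simp [hi]⟩
      | some e =>
        obtain ⟨i, hi⟩ := hV e
        exact ⟨Sum.inr i, by simp [hi]⟩
    · convert (hVA (fun e => x (some e))).2 (x none) using 1
      funext i
      cases i with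
      | inl i =>
        simp only [sub, Sum.elim_inl]
        cases L i <;> rfl
      | inr j =>
        simp only [sub, Sum.elim_inr]
        cases V j <;> rfl

end NLog


namespace NLog

/-- Replace the letter `none` by `a`. -/
def rr {ι α : Type*} (a : α) (x : ι → Option α) : ι → Option α := fun i => some ((x i).getD a)

/-- `D` does not distinguish the letters `none` and `a`. -/
def Insens {ι α : Type*} (a : α) (D : (ι → Option α) → Prop) : Prop := ∀ x, D x ↔ D (rr a x)

lemma rr_sub_rr {ι η α : Type*} (a : α) (V : ι → Option α ⊕ η) (x : η → Option α) :
    rr a (sub V (rr a x)) = rr a (sub V x) := by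
  funext i
  simp only [rr, sub]
  cases V i <;> rfl

lemma Insens.congr {ι α : Type*} {a : α} {D : (ι → Option α) → Prop} (h : Insens a D)
    {x y : ι → Option α} (hxy : rr a x = rr a y) : D x ↔ D y := by
  rw [h x, h y, hxy]

lemma rr_rr {ι α : Type*} (a : α) (x : ι → Option α) : rr a (rr a x) = rr a x := rfl

lemma Insens.sub {ι η α : Type*} {a : α} {D : (ι → Option α) → Prop} (h : Insens a D)
    (V : ι → Option α ⊕ η) : Insens a (fun x => D (sub V x)) := fun x =>
  h.congr (rr_sub_rr a V x).symm

lemma rr_elim {ι κ α : Type*} (a : α) (x : ι → Option α) (y : κ → Option α) :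
    rr a (Sum.elim x y) = Sum.elim (rr a x) (rr a y) := by
  funext i; cases i <;> rfl

lemma Insens.right {ι κ α : Type*} {a : α} {D : (ι ⊕ κ → Option α) → Prop} (h : Insens a D)
    (x : ι → Option α) : Insens a (fun y => D (Sum.elim x y)) := fun y =>
  h.congr (by rw [rr_elim, rr_elim, rr_rr])

lemma Insens.left {ι κ α : Type*} {a : α} {D : (ι ⊕ κ → Option α) → Prop} (h : Insens a D)
    (y : κ → Option α) : Insens a (fun x => D (Sum.elim x y)) := fun y =>
  h.congr (by rw [rr_elim, rr_elim, rr_rr])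

lemma EE_invol {X Y : Type*} [Finite X] [Finite Y] (φ : X × Y → X × Y)
    (h : Function.Involutive φ) (f : X × Y → ℝ) : EE (fun p => f (φ p)) = EE f :=
  EE_equiv h.toPerm f

/-- The word that is `none` where `b` is, and given by `y` elsewhere. -/
def mrg {ι α : Type*} (b : ι → Option α) (y : ι → α) : ι → Option α :=
  fun i => (b i).map fun _ => y i

lemma EE_mrg {ι α : Type*} [Finite ι] [Finite α] [Nonempty α] (f : (ι → Option α) → ℝ) :
    EE f = EE fun b : ι → Option α => EE fun y : ι → α => f (mrg b y) := by
  have h := EE_invol (X := ι → Option α) (Y := ι → α)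
    (fun p => (mrg p.1 p.2, fun i => (p.1 i).getD (p.2 i))) (by
      rintro ⟨b, y⟩
      refine Prod.ext ?_ ?_
      · funext i
        simp only [mrg]
        cases b i <;> rfl
      · funext i
        simp only [mrg]
        cases b i <;> rfl) (fun p => f p.1)
  rw [← EE_prod fun (b : ι → Option α) (y : ι → α) => f (mrg b y)]
  rw [h, EE_prod fun (b : ι → Option α) (_ : ι → α) => f b]
  simp only [EE_const]

open Classical in
/-- Insert the word `u` at a section. -/
noncomputable def cmb {ι₀ κ α : Type*} (σ : ι₀ → κ) (y : ι₀ × κ → α) (u : ι₀ → α) : ι₀ × κ → α :=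
  fun p => if p.2 = σ p.1 then u p.1 else y p

lemma EE_cmb {ι₀ κ α : Type*} [Finite ι₀] [Finite κ] [Finite α] [Nonempty α] (σ : ι₀ → κ)
    (f : (ι₀ × κ → α) → ℝ) :
    EE f = EE fun y : ι₀ × κ → α => EE fun u : ι₀ → α => f (cmb σ y u) := by
  have h := EE_invol (X := ι₀ × κ → α) (Y := ι₀ → α)
    (fun p => (cmb σ p.1 p.2, fun i => p.1 (i, σ i))) (by
      rintro ⟨b, y⟩
      refine Prod.ext ?_ ?_
      · funext ⟨i, j⟩
        by_cases hj : j = σ i <;> simp [cmb, hj]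
      · funext i
        simp [cmb]) (fun p => f p.1)
  rw [← EE_prod fun (y : ι₀ × κ → α) (u : ι₀ → α) => f (cmb σ y u)]
  rw [h, EE_prod fun (y : ι₀ × κ → α) (_ : ι₀ → α) => f y]
  simp only [EE_const]

lemma EE_ind_eq {X : Type*} [Finite X] (v : X) : EE (fun x => ind (x = v)) = 1 / (Nat.card X : ℝ) := by
  classical
  cases nonempty_fintype X
  rw [EE_eq]
  congr 1
  simp [ind]

/-- Dense insensitive sets contain subspaces. -/
lemma insens_subspace {α : Type} [Finite α] [Nonempty α] (H : DHJ α) (a : α) (η : Type) [Finite η]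
    (ε : ℝ) (hε : 0 < ε) : ∃ (ι : Type) (_ : Finite ι), ∀ D : (ι → Option α) → Prop,
      Insens a D → ε ≤ EE (fun x => ind (D x)) →
      ∃ V : ι → Option α ⊕ η, Proper V ∧ ∀ x, D (sub V x) := by
  obtain ⟨ι₀, hι₀, h₀⟩ := MDHJ H η (ε / 2) (by positivity)
  cases nonempty_fintype ι₀
  have hk : 1 < Nat.card (Option α) := by
    rw [Finite.one_lt_card_iff_nontrivial]
    infer_instance
  obtain ⟨M, hM⟩ : ∃ M : ℕ, (Fintype.card ι₀ : ℝ) * (1 / (Nat.card (Option α) : ℝ)) ^ M < ε / 2 := by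
    have h1 : (1 / (Nat.card (Option α) : ℝ)) < 1 := by
      rw [div_lt_one (by positivity)]
      exact_mod_cast hk
    have h2 := (tendsto_pow_atTop_nhds_zero_of_lt_one (by positivity) h1).const_mul
      (Fintype.card ι₀ : ℝ)
    rw [mul_zero] at h2
    exact (h2.eventually_lt_const (by positivity)).exists
  refine ⟨ι₀ × Fin M, inferInstance, fun D hD hdD => ?_⟩
  rw [EE_mrg] at hdD
  -- the bad event
  have hbad : EE (fun b : ι₀ × Fin M → Option α => ind (∃ i, ∀ j, b (i, j) = none)) ≤ ε / 2 := by
    refine le_trans ?_ hM.le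
    have h1 : EE (fun b : ι₀ × Fin M → Option α => ind (∃ i, ∀ j, b (i, j) = none)) ≤
        EE (fun b : ι₀ × Fin M → Option α => ∑ i : ι₀, ind (∀ j, b (i, j) = none)) := by
      apply EE_mono
      intro b
      by_cases h : ∃ i, ∀ j, b (i, j) = none
      · obtain ⟨i, hi⟩ := h
        have := Finset.single_le_sum (f := fun i => ind (∀ j, b (i, j) = none))
          (fun i _ => ind_nonneg _) (Finset.mem_univ i)
        rw [ind_true hi] at this
        exact (ind_le_one _).trans this
      · rw [ind_false h]
        exact Finset.sum_nonneg fun i _ => ind_nonneg _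
    refine h1.trans ?_
    rw [EE_sum]
    have h2 : ∀ i : ι₀, EE (fun b : ι₀ × Fin M → Option α => ind (∀ j, b (i, j) = none)) =
        (1 / (Nat.card (Option α) : ℝ)) ^ M := by
      intro i
      rw [← EE_equiv (Equiv.curry ι₀ (Fin M) (Option α)).symm]
      have h3 := EE_marginal (X := Fin M → Option α) i (fun v => ind (v = fun _ => none))
      rw [EE_ind_eq] at h3
      have h4 : (1 : ℝ) / (Nat.card (Fin M → Option α) : ℝ) =
          (1 / (Nat.card (Option α) : ℝ)) ^ M := by
        rw [Nat.card_fun]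
        simp
      rw [← h4, ← h3]
      apply EE_congr
      intro x
      congr 1
      rw [funext_iff]
      rfl
    rw [Finset.sum_congr rfl fun i _ => h2 i]
    simp
  obtain ⟨b, hb⟩ := exists_EE_le (fun b : ι₀ × Fin M → Option α =>
    (EE fun y : ι₀ × Fin M → α => ind (D (mrg b y))) - ind (∃ i, ∀ j, b (i, j) = none))
  rw [EE_sub] at hb
  have hgood : ¬ ∃ i, ∀ j, b (i, j) = none := by
    intro h
    rw [ind_true h] at hb
    have : EE (fun y : ι₀ × Fin M → α => ind (D (mrg b y))) ≤ 1 := EE_le fun y => ind_le_one _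
    linarith
  rw [ind_false hgood] at hb
  push Not at hgood
  choose σ hσ using hgood
  rw [EE_cmb σ (fun y => ind (D (mrg b y)))] at hb
  obtain ⟨y, hy⟩ := exists_EE_le (fun y : ι₀ × Fin M → α =>
    EE fun u : ι₀ → α => ind (D (mrg b (cmb σ y u))))
  obtain ⟨V₀, hV₀, hV₀D⟩ := h₀ (fun u => D (mrg b (cmb σ y u))) (by linarith)
  classical
  refine ⟨fun p => if p.2 = σ p.1 then Sum.map some id (V₀ p.1) else Sum.inl (mrg b y p),
    fun e => ?_, fun x => ?_⟩
  · obtain ⟨i, hi⟩ := hV₀ e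
    exact ⟨(i, σ i), by simp [hi]⟩
  · refine (hD.congr ?_).1 (hV₀D (fun e => (x e).getD a))
    funext ⟨i, j⟩
    by_cases hj : j = σ i
    · subst hj
      obtain ⟨c, hc⟩ := Option.ne_none_iff_exists'.1 (hσ i)
      simp only [rr, sub, mrg, cmb, hc, if_true, Option.map_some, Option.getD_some]
      cases V₀ i <;> rfl
    · simp [rr, sub, mrg, cmb, hj]

/-- All averages of `f` over `η`-dimensional subspaces are nonpositive. -/
def Avg0 {ι β : Type*} [Finite β] (η : Type) [Finite η] (f : (ι → β) → ℝ) : Prop :=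
  ∀ V : ι → β ⊕ η, Proper V → EE (fun x => f (sub V x)) ≤ 0

/-- Correlation with one insensitive set, iterated form. -/
lemma insens_step {α : Type} [Finite α] [Nonempty α] (H : DHJ α) (a : α) (η : Type) [Finite η]
    (ε : ℝ) (hε : 0 < ε) : ∃ ρ : ℝ, 0 < ρ ∧ ρ ≤ 1 ∧ ∀ t : ℕ, ∃ (ι : Type) (_ : Finite ι),
      ∀ D : (ι → Option α) → Prop, Insens a D → ∀ f : (ι → Option α) → ℝ, (∀ x, f x ≤ 1) →
        Avg0 η f → EE (fun x => f x * ind (D x)) ≤ 2 * ε + (1 - ρ) ^ t * EE (fun x => ind (D x)) := by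
  obtain ⟨ι₁, hι₁, h₁⟩ := insens_subspace H a η ε hε
  set K : ℝ := (Nat.card (ι₁ → Option α ⊕ η) : ℝ) with hK
  set B : ℝ := (Nat.card (ι₁ → Option α) : ℝ) with hB
  have hK1 : 1 ≤ K := by
    have : 0 < Nat.card (ι₁ → Option α ⊕ η) := Nat.card_pos
    rw [hK]; exact_mod_cast this
  have hB1 : 1 ≤ B := by
    have : 0 < Nat.card (ι₁ → Option α) := Nat.card_pos
    rw [hB]; exact_mod_cast this
  refine ⟨min 1 (1 / B * (ε / K)), by positivity, min_le_left _ _, fun t => ?_⟩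
  set ρ := min 1 (1 / B * (ε / K)) with hρ
  have hρ0 : 0 < ρ := by positivity
  have hρ1 : ρ ≤ 1 := min_le_left _ _
  have hρ2 : ρ ≤ 1 / B * (ε / K) := min_le_right _ _
  induction t with
  | zero =>
    refine ⟨PEmpty, inferInstance, fun D hD f hf hA => ?_⟩
    have : EE (fun x => f x * ind (D x)) ≤ EE (fun x => ind (D x)) :=
      EE_mono fun x => by nlinarith [hf x, ind_nonneg (D x)]
    simp only [pow_zero, one_mul]
    linarith
  | succ t IH =>
    obtain ⟨ι₂, hι₂, h₂⟩ := IH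
    refine ⟨ι₁ ⊕ ι₂, inferInstance, fun D hD f hf hA => ?_⟩
    have hlam : 0 ≤ (1 - ρ) ^ t := pow_nonneg (by linarith) t
    have hlam' : 0 ≤ (1 - ρ) ^ (t + 1) := pow_nonneg (by linarith) _
    have hdnn : 0 ≤ EE (fun x => ind (D x)) := EE_nonneg fun x => ind_nonneg _
    have hd1 : EE (fun x => ind (D x)) ≤ 1 := EE_le fun x => ind_le_one _
    rcases le_or_gt (EE (fun x => ind (D x))) (2 * ε) with hd | hd
    · have : EE (fun x => f x * ind (D x)) ≤ EE (fun x => ind (D x)) :=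
        EE_mono fun x => by nlinarith [hf x, ind_nonneg (D x)]
      nlinarith
    have hd' := hd
    rw [EE_sumType, EE_comm] at hd'
    obtain ⟨V, hV⟩ := pop (L := ι₁ → Option α ⊕ η) hε
      (g := fun y : ι₂ → Option α => EE fun x : ι₁ → Option α => ind (D (Sum.elim x y)))
      (fun y => EE_le fun x => ind_le_one _) hd'.le
      (fun y V => Proper V ∧ ∀ x, D (Sum.elim (sub V x) y))
      (fun y hy => h₁ _ (hD.left y) hy)
    rw [← hK] at hV
    set T : (ι₂ → Option α) → Prop := fun y => Proper V ∧ ∀ x, D (Sum.elim (sub V x) y) with hT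
    set S : (ι₁ → Option α) → Prop := fun u => ∃ x, sub V x = u with hS
    have hVp : Proper V := by
      obtain ⟨y, hy⟩ := exists_EE_le (fun y => ind (T y))
      have : 0 < ε / K := by positivity
      exact (of_ind_pos (p := T y) (by linarith)).1
    have hTi : Insens a T := fun y => and_congr Iff.rfl (forall_congr' fun x => hD.right _ y)
    have hSTD : ∀ u y, S u → T y → D (Sum.elim u y) := by
      rintro u y ⟨x, rfl⟩ hy
      exact hy.2 x
    -- splitting
    have hsplit : ∀ u y, ind (D (Sum.elim u y)) =
        ind (S u) * ind (T y) + ind (D (Sum.elim u y) ∧ ¬ (S u ∧ T y)) := by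
      intro u y
      by_cases hs : S u <;> by_cases ht : T y
      · rw [ind_true (hSTD u y hs ht), ind_true hs, ind_true ht, ind_false (by tauto)]; ring
      all_goals
        by_cases hd : D (Sum.elim u y) <;> simp [ind, hs, ht, hd]
    have hfirst : (EE fun u => EE fun y => f (Sum.elim u y) * (ind (S u) * ind (T y))) ≤ 0 := by
      rw [EE_comm]
      have : ∀ y, (EE fun u => f (Sum.elim u y) * (ind (S u) * ind (T y))) ≤ 0 := by
        intro y
        have e1 : (EE fun u => f (Sum.elim u y) * (ind (S u) * ind (T y))) =
            (EE fun u => f (Sum.elim u y) * ind (S u)) * ind (T y) := by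
          rw [← EE_mul_right]
          exact EE_congr fun u => by ring
        rw [e1]
        refine mul_nonpos_of_nonpos_of_nonneg ?_ (ind_nonneg _)
        have h3 := hA (padR V y) (hVp.padR y)
        simp only [sub_padR] at h3
        classical
        cases nonempty_fintype (ι₁ → Option α)
        cases nonempty_fintype (η → Option α)
        rw [EE_eq] at h3 ⊢
        have e2 : ∑ u, f (Sum.elim u y) * ind (S u) = ∑ x, f (Sum.elim (sub V x) y) := by
          have e3 : ∑ x, f (Sum.elim (sub V x) y) =
              ∑ u ∈ Finset.univ.image (sub V), f (Sum.elim u y) :=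
            (Finset.sum_image (f := fun u => f (Sum.elim u y))
              (fun x _ x' _ h => hVp.injective h)).symm
          rw [e3]
          rw [← Finset.sum_subset (Finset.subset_univ (Finset.univ.image (sub V)))]
          · apply Finset.sum_congr rfl
            intro u hu
            rw [ind_true, mul_one]
            simpa [hS] using hu
          · intro u _ hu
            rw [ind_false, mul_zero]
            simpa [hS] using hu
        rw [e2]
        have hc : (0 : ℝ) < Nat.card (η → Option α) := by exact_mod_cast Nat.card_pos
        have h4 : ∑ x, f (Sum.elim (sub V x) y) ≤ 0 := by
          by_contra! h5
          exact absurd (div_pos h5 hc) (not_lt.2 h3)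
        exact div_nonpos_of_nonpos_of_nonneg h4 (Nat.cast_nonneg _)
      exact EE_le this
    have hsecond : (EE fun u => EE fun y =>
        f (Sum.elim u y) * ind (D (Sum.elim u y) ∧ ¬ (S u ∧ T y))) ≤
        2 * ε + (1 - ρ) ^ t * EE fun u => EE fun y => ind (D (Sum.elim u y) ∧ ¬ (S u ∧ T y)) := by
      have : ∀ u, (EE fun y => f (Sum.elim u y) * ind (D (Sum.elim u y) ∧ ¬ (S u ∧ T y))) ≤
          2 * ε + (1 - ρ) ^ t * EE fun y => ind (D (Sum.elim u y) ∧ ¬ (S u ∧ T y)) := by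
        intro u
        refine h₂ (fun y => D (Sum.elim u y) ∧ ¬ (S u ∧ T y)) (fun y => ?_)
          (fun y => f (Sum.elim u y)) (fun y => hf _) (fun W hW => ?_)
        · have := hD.right u y
          have := hTi y
          tauto
        · have h3 := hA (padL u W) (hW.padL u)
          simpa only [sub_padL] using h3
      refine (EE_mono this).trans ?_
      rw [EE_add, EE_const, EE_mul_left]
    have hST : ρ ≤ EE fun u => EE fun y => ind (S u) * ind (T y) := by
      simp only [EE_mul_left, EE_mul_right]
      refine hρ2.trans (mul_le_mul ?_ hV (by positivity) (EE_nonneg fun u => ind_nonneg _))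
      have h3 := single_le_EE (f := fun u => ind (S u)) (fun u => ind_nonneg _)
        (sub V fun _ => none)
      rw [ind_true ⟨_, rfl⟩] at h3
      exact h3
    have htot : EE (fun x => ind (D x)) = (EE fun u => EE fun y => ind (S u) * ind (T y)) +
        EE fun u => EE fun y => ind (D (Sum.elim u y) ∧ ¬ (S u ∧ T y)) := by
      rw [EE_sumType, ← EE_add]
      apply EE_congr; intro u
      rw [← EE_add]
      exact EE_congr fun y => hsplit u y
    have hftot : EE (fun x => f x * ind (D x)) =
        (EE fun u => EE fun y => f (Sum.elim u y) * (ind (S u) * ind (T y))) +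
        EE fun u => EE fun y => f (Sum.elim u y) * ind (D (Sum.elim u y) ∧ ¬ (S u ∧ T y)) := by
      rw [EE_sumType, ← EE_add]
      apply EE_congr; intro u
      rw [← EE_add]
      exact EE_congr fun y => by rw [hsplit u y]; ring
    have h5 : (EE fun u => EE fun y => ind (D (Sum.elim u y) ∧ ¬ (S u ∧ T y))) ≤
        (1 - ρ) * EE (fun x => ind (D x)) := by nlinarith
    have h6 := mul_le_mul_of_nonneg_left h5 hlam
    rw [pow_succ, mul_assoc]
    linarith

/-- Correlation with one insensitive set. -/
lemma insens_one {α : Type} [Finite α] [Nonempty α] (H : DHJ α) (a : α) (η : Type) [Finite η]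
    (ε : ℝ) (hε : 0 < ε) : ∃ (ι : Type) (_ : Finite ι),
      ∀ D : (ι → Option α) → Prop, Insens a D → ∀ f : (ι → Option α) → ℝ, (∀ x, f x ≤ 1) →
        Avg0 η f → EE (fun x => f x * ind (D x)) ≤ ε := by
  obtain ⟨ρ, hρ0, hρ1, h⟩ := insens_step H a η (ε / 3) (by positivity)
  obtain ⟨t, ht⟩ := exists_pow_lt_of_lt_one (show 0 < ε / 3 by positivity)
    (show 1 - ρ < 1 by linarith)
  obtain ⟨ι, hι, h⟩ := h t
  refine ⟨ι, hι, fun D hD f hf hA => (h D hD f hf hA).trans ?_⟩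
  have hd1 : EE (fun x => ind (D x)) ≤ 1 := EE_le fun x => ind_le_one _
  have : 0 ≤ (1 - ρ) ^ t := pow_nonneg (by linarith) t
  nlinarith

/-- Correlation with an intersection of insensitive sets. -/
lemma insens_inter {α : Type} [Finite α] [Nonempty α] (H : DHJ α) (s : Finset α) :
    ∀ (η : Type) [Finite η] (ε : ℝ), 0 < ε → ∃ (ι : Type) (_ : Finite ι),
      ∀ D : α → (ι → Option α) → Prop, (∀ a, Insens a (D a)) →
      ∀ f : (ι → Option α) → ℝ, (∀ x, f x ≤ 1) →
        Avg0 η f → EE (fun x => f x * ind (∀ a ∈ s, D a x)) ≤ ε := by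
  classical
  induction s using Finset.induction_on with
  | empty =>
    intro η _ ε hε
    refine ⟨η, inferInstance, fun D hD f hf hA => ?_⟩
    have h := hA Sum.inr (fun e => ⟨e, rfl⟩)
    refine le_trans (le_of_eq ?_) (h.trans hε.le)
    apply EE_congr
    intro x
    rw [ind_true (by simp), mul_one]
    rfl
  | insert a s ha IH =>
    intro η _ ε hε
    obtain ⟨η', hη', h'⟩ := IH η (ε / 2) (by positivity)
    obtain ⟨ι, hι, h⟩ := insens_one H a η' (ε / 2) (by positivity)
    refine ⟨ι, hι, fun D hD f hf hA => ?_⟩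
    have h1 := h (D a) (hD a) (fun x => f x * ind (∀ b ∈ s, D b x) - ε / 2) (fun x => ?_)
      (fun V hV => ?_)
    · have e : EE (fun x => f x * ind (∀ b ∈ insert a s, D b x)) =
          EE (fun x => (f x * ind (∀ b ∈ s, D b x) - ε / 2) * ind (D a x)) +
          EE (fun x => ε / 2 * ind (D a x)) := by
        rw [← EE_add]
        apply EE_congr
        intro x
        have : ind (∀ b ∈ insert a s, D b x) = ind (D a x) * ind (∀ b ∈ s, D b x) := by
          rw [← ind_and]; simp
        rw [this]; ring
      rw [e, EE_mul_left]
      have hd1 : EE (fun x => ind (D a x)) ≤ 1 := EE_le fun x => ind_le_one _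
      nlinarith
    · have := hf x
      have h2 := ind_nonneg (∀ b ∈ s, D b x)
      have h3 := ind_le_one (∀ b ∈ s, D b x)
      nlinarith
    · have h2 := h' (fun b x => D b (sub V x)) (fun b => (hD b).sub V) (fun x => f (sub V x))
        (fun x => hf _) (fun U hU => ?_)
      · rw [EE_sub, EE_const]
        linarith
      · have := hA (comp V U) (hV.comp hU)
        simpa only [sub_comp] using this

/-- Correlation with the complement of an intersection of insensitive sets. -/
lemma insens_compl {α : Type} [Finite α] [Nonempty α] (H : DHJ α)
    (η : Type) [Finite η] (ε : ℝ) (hε : 0 < ε) : ∃ (ι : Type) (_ : Finite ι),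
      ∀ D : α → (ι → Option α) → Prop, (∀ a, Insens a (D a)) →
      ∀ f : (ι → Option α) → ℝ, (∀ x, f x ≤ 1) →
        Avg0 η f → EE (fun x => f x * ind (¬ ∀ a, D a x)) ≤ Nat.card α * ε := by
  classical
  cases nonempty_fintype α
  obtain ⟨ι, hι, h⟩ := insens_inter H Finset.univ η ε hε
  refine ⟨ι, hι, fun D hD f hf hA => ?_⟩
  have key : ∀ s : Finset α, EE (fun x => f x * ind (¬ ∀ a ∈ s, D a x)) ≤ s.card * ε := by
    intro s
    induction s using Finset.induction_on with
    | empty =>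
      simp [ind]
      exact EE_le fun x => le_rfl
    | insert a s ha IH =>
      have h1 := h (fun b x => if b = a then ¬ D a x else (b ∈ s → D b x)) (fun b => ?_) f hf hA
      · have e : EE (fun x => f x * ind (¬ ∀ b ∈ insert a s, D b x)) =
            EE (fun x => f x * ind (¬ ∀ b ∈ s, D b x)) +
            EE (fun x => f x * ind (∀ b ∈ Finset.univ,
              if b = a then ¬ D a x else (b ∈ s → D b x))) := by
          rw [← EE_add]
          apply EE_congr
          intro x
          rw [← mul_add]
          congr 1
          have e1 : (∀ b ∈ insert a s, D b x) ↔ (D a x ∧ ∀ b ∈ s, D b x) := by simp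
          have e2 : (∀ b ∈ Finset.univ, if b = a then ¬ D a x else (b ∈ s → D b x)) ↔
              (¬ D a x ∧ ∀ b ∈ s, D b x) := by
            constructor
            · intro hh
              refine ⟨by simpa using hh a (Finset.mem_univ _), fun b hb => ?_⟩
              have hba : b ≠ a := fun e => ha (e ▸ hb)
              have := hh b (Finset.mem_univ _)
              rw [if_neg hba] at this
              exact this hb
            · rintro ⟨h3, h4⟩ b _
              by_cases hba : b = a
              · rw [if_pos hba]; exact h3
              · rw [if_neg hba]; exact h4 b
          rw [e1, e2]
          generalize (∀ b ∈ s, D b x) = Q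
          by_cases h3 : D a x <;> by_cases h4 : Q <;> simp [ind, h3, h4]
        rw [e, Finset.card_insert_of_notMem ha]
        push_cast
        linarith
      · by_cases hba : b = a
        · subst hba
          intro x
          simp only [if_true]
          exact not_congr (hD b x)
        · intro x
          simp only [if_neg hba]
          exact imp_congr Iff.rfl (hD b x)
  have := key Finset.univ
  simpa using this

end NLog


namespace NLog

/-- Multidimensional Hales-Jewett, from Mathlib. -/
lemma HJ (γ κ η : Type) [Finite γ] [Finite κ] [Finite η] : ∃ (ι : Type) (_ : Finite ι),
    ∀ C : (ι → γ) → κ, ∃ V : ι → γ ⊕ η, Proper V ∧ ∃ c, ∀ x, C (sub V x) = c := by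
  obtain ⟨ι, hι, h⟩ := Combinatorics.Subspace.exists_mono_in_high_dimension γ κ η
  refine ⟨ι, inferInstance, fun C => ?_⟩
  obtain ⟨l, c, hc⟩ := h C
  exact ⟨l.idxFun, l.proper, c, hc⟩

/-- Prepend a letter. -/
def cons {ι γ : Type*} (a : γ) (x : ι → γ) : Option ι → γ := fun i => i.elim a x

/-- A Ramsey theorem for combinatorial lines (variable words): either there is a subspace all
of whose points (with some `none` always present) are good, or there is a subspace
without fixed `none` all of whose lines are bad. -/
lemma GR (α : Type) [Finite α] (η : Type) [Finite η] :
    ∀ (J : Type) [Finite J] (ζ : Type) [Finite ζ], ∃ (ι : Type) (_ : Finite ι),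
      ∀ G : J → (ι → Option α) → Prop,
        (∃ j, ∃ V : ι → Option α ⊕ ζ, Proper V ∧ (∃ i, V i = Sum.inl none) ∧ ∀ x, G j (sub V x)) ∨
        (∃ U : ι → Option α ⊕ η, Proper U ∧ (∀ i, U i ≠ Sum.inl none) ∧
          ∀ j, ∀ x : η → Option α, (∃ e, x e = none) → ¬ G j (sub U x)) := by
  induction η using Finite.induction_empty_option with
  | of_equiv e IH =>
    intro J _ ζ _
    obtain ⟨ι, hι, h⟩ := IH J ζ
    refine ⟨ι, hι, fun G => ?_⟩
    rcases h G with h | ⟨U, hU, hn, hb⟩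
    · exact Or.inl h
    · right
      refine ⟨fun i => Sum.map id e (U i), fun f => ?_, fun i => ?_, fun j x hx => ?_⟩
      · obtain ⟨i, hi⟩ := hU (e.symm f)
        exact ⟨i, by simp [hi]⟩
      · have := hn i
        cases hi : U i with
        | inl c => rw [hi] at this; simpa [hi] using this
        | inr c => simp [hi]
      · obtain ⟨f, hf⟩ := hx
        convert hb j (fun f => x (e f)) ⟨e.symm f, by simpa using hf⟩ using 2
        funext i
        simp only [sub]
        cases U i <;> rfl
  | h_empty =>
    intro J _ ζ _
    refine ⟨PEmpty, inferInstance, fun G => Or.inr ?_⟩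
    exact ⟨fun i => i.elim, fun e => e.elim, fun i => i.elim, fun j x ⟨e, _⟩ => e.elim⟩
  | @h_option η _ IH =>
    intro J _ ζ _
    obtain ⟨ι', hι', h'⟩ := IH (J × α) ζ
    obtain ⟨ι₁, hι₁, h₁⟩ := HJ (Option α) (J → Prop) (ζ ⊕ ι')
    refine ⟨Option ι₁, inferInstance, fun G => ?_⟩
    obtain ⟨V, hV, c, hc⟩ := h₁ (fun x j => G j (cons none x))
    by_cases hgood : ∃ j, c j
    · -- a good subspace
      obtain ⟨j, hj⟩ := hgood
      left
      refine ⟨j, fun i => i.elim (Sum.inl none) fun i =>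
        comp V (Sum.elim Sum.inr fun _ => Sum.inl none) i, fun e => ?_, ⟨none, rfl⟩, fun x => ?_⟩
      · obtain ⟨i, hi⟩ := hV (Sum.inl e)
        exact ⟨some i, by simp [comp, hi]⟩
      · have h2 := congrFun (hc (Sum.elim x fun _ => none)) j
        have h3 : G j (cons none (sub V (Sum.elim x fun _ => none))) := by rw [h2]; exact hj
        convert h3 using 1
        funext i
        cases i with
        | none => rfl
        | some i =>
          simp only [sub, cons, Option.elim_some, comp]
          rcases V i with c | (c | c) <;> rfl
    · push Not at hgood
      -- the new parameter
      set V' : ι₁ → Option α ⊕ ι' := comp V (Sum.elim (fun _ => Sum.inl none) Sum.inr) with hV'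
      have hV'p : Proper V' := fun e => by
        obtain ⟨i, hi⟩ := hV (Sum.inr e)
        exact ⟨i, by simp [hV', comp, hi]⟩
      have hbad : ∀ j x, ¬ G j (cons none (sub V' x)) := by
        intro j x
        have h2 := congrFun (hc (sub (Sum.elim (fun _ => Sum.inl none) Sum.inr) x)) j
        rw [hV', sub_comp, h2]
        exact hgood j
      let U₁ : Option ι₁ → Option α ⊕ Option ι' := fun i => i.elim (Sum.inr none) fun i =>
        Sum.elim (fun c => c.elim (Sum.inr none) fun c => Sum.inl (some c))
          (fun e => Sum.inr (some e)) (V' i)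
      have hU₁ : Proper U₁ := by
        intro e
        cases e with
        | none => exact ⟨none, rfl⟩
        | some e =>
          obtain ⟨i, hi⟩ := hV'p e
          exact ⟨some i, by simp [U₁, hi]⟩
      have hU₁n : ∀ i, U₁ i ≠ Sum.inl none := by
        intro i
        cases i with
        | none => simp [U₁]
        | some i => rcases hi : V' i with (_ | c) | c <;> simp [U₁, hi]
      have hU₁s : ∀ x, sub U₁ (cons none x) = cons none (sub V' x) := by
        intro x
        funext i
        cases i with
        | none => rfl
        | some i => rcases hi : V' i with (_ | c) | c <;> simp [U₁, hi, sub, cons]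
      rcases h' (fun p x => G p.1 (sub U₁ (cons (some p.2) x))) with
        ⟨⟨j, a⟩, W, hW, ⟨i₀, hi₀⟩, hWG⟩ | ⟨U, hU, hUn, hUb⟩
      · left
        refine ⟨j, comp U₁ (fun i => i.elim (Sum.inl (some a)) W), fun e => ?_, ?_, fun x => ?_⟩
        · obtain ⟨i, hi⟩ := hW e
          obtain ⟨i', hi'⟩ := hU₁ (some i)
          exact ⟨i', by simp [comp, hi', hi]⟩
        · obtain ⟨i', hi'⟩ := hU₁ (some i₀)
          exact ⟨i', by simp [comp, hi', hi₀]⟩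
        · rw [sub_comp]
          convert hWG x using 2
          funext i
          cases i <;> rfl
      · right
        refine ⟨comp U₁ (fun i => i.elim (Sum.inr none) fun i => Sum.map id some (U i)),
          hU₁.comp fun e => ?_, fun i => ?_, fun j x hx => ?_⟩
        · cases e with
          | none => exact ⟨none, rfl⟩
          | some e =>
            obtain ⟨i, hi⟩ := hU e
            exact ⟨some i, by simp [hi]⟩
        · rcases hi : U₁ i with c | (_ | c)
          · have := hU₁n i
            rw [hi] at this
            simpa [comp, hi] using this
          · simp [comp, hi]
          · have := hUn c
            rcases hc : U c with d | d
            · rw [hc] at this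
              simpa [comp, hi, hc] using this
            · simp [comp, hi, hc]
        · rw [sub_comp]
          have e1 : sub (fun i : Option ι' => i.elim (Sum.inr none) fun i =>
              Sum.map id some (U i)) x = cons (x none) (sub U fun e => x (some e)) := by
            funext i
            cases i with
            | none => rfl
            | some i =>
              simp only [sub, cons, Option.elim_some]
              cases U i <;> rfl
          rw [e1]
          cases hx0 : x none with
          | none =>
            rw [hU₁s]
            exact hbad j _
          | some a =>
            refine hUb (j, a) (fun e => x (some e)) ?_
            obtain ⟨e, he⟩ := hx
            cases e with
            | none => rw [hx0] at he; cases he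
            | some e => exact ⟨e, he⟩

/-- The inductive step of the density Hales-Jewett theorem. -/
lemma DHJ_option {α : Type} [Finite α] [Nonempty α] (H : DHJ α) : DHJ (Option α) := by
  by_contra hcon
  simp only [DHJ] at hcon
  push Not at hcon
  obtain ⟨δ₀, hδ₀, hcon⟩ := hcon
  set LF : Set ℝ := {d | ∀ (ι : Type) (_ : Finite ι), ∃ A : (ι → Option α) → Prop,
    d ≤ EE (fun x => ind (A x)) ∧ ¬ HasLine A} with hLF
  have hmem : δ₀ ∈ LF := hcon
  have hbdd : BddAbove LF := by
    refine ⟨1, fun d hd => ?_⟩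
    obtain ⟨A, hA, _⟩ := hd PEmpty inferInstance
    exact hA.trans (EE_le fun x => ind_le_one _)
  set δ := sSup LF with hδ
  have hδpos : 0 < δ := hδ₀.trans_le (le_csSup hbdd hmem)
  have up : ∀ γ : ℝ, 0 < γ → ∃ (η : Type) (_ : Finite η), ∀ A : (η → Option α) → Prop,
      ¬ HasLine A → EE (fun x => ind (A x)) ≤ δ + γ := by
    intro γ hγ
    by_contra! h
    have : δ + γ ∈ LF := by
      intro η hη
      obtain ⟨A, h1, h2⟩ := h η hη
      exact ⟨A, h2.le, h1⟩
    have := le_csSup hbdd this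
    linarith
  have low : ∀ γ : ℝ, 0 < γ → ∀ (ι : Type) (_ : Finite ι), ∃ A : (ι → Option α) → Prop,
      δ - γ ≤ EE (fun x => ind (A x)) ∧ ¬ HasLine A := by
    intro γ hγ ι hι
    obtain ⟨d, hd, hd2⟩ := exists_lt_of_lt_csSup ⟨_, hmem⟩ (show δ - γ < sSup LF by linarith)
    obtain ⟨A, h1, h2⟩ := hd ι hι
    exact ⟨A, by linarith, h2⟩
  have hδ1 : δ ≤ 1 := csSup_le ⟨_, hmem⟩ fun d hd => by
    obtain ⟨A, hA, _⟩ := hd PEmpty inferInstance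
    exact hA.trans (EE_le fun x => ind_le_one _)
  -- constants
  obtain ⟨ι₀, hι₀, h₀⟩ := H (δ / 4) (by positivity)
  set L : ℝ := (Nat.card (ι₀ → Option α) : ℝ) with hL
  have hL1 : 1 ≤ L := by
    have : 0 < Nat.card (ι₀ → Option α) := Nat.card_pos
    rw [hL]; exact_mod_cast this
  set θ : ℝ := δ / 4 / L with hθ
  have hθ0 : 0 < θ := by positivity
  have hθ1 : θ ≤ 1 := by
    rw [hθ, div_le_one (by positivity)]
    linarith
  set k : ℝ := (Nat.card α : ℝ) with hk
  have hk1 : 1 ≤ k := by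
    have : 0 < Nat.card α := Nat.card_pos
    rw [hk]; exact_mod_cast this
  set γ : ℝ := δ * θ / 8 with hγ
  have hγ0 : 0 < γ := by positivity
  obtain ⟨η, hη, hup⟩ := up γ hγ0
  obtain ⟨ζ, hζ, hcor⟩ := insens_compl H η (δ * θ / 4 / k) (by positivity)
  obtain ⟨ιG, hιG, hGR⟩ := GR α ι₀ Unit ζ
  set B : ℝ := (Nat.card (ιG → Option α) : ℝ) with hB
  have hB1 : 1 ≤ B := by
    have : 0 < Nat.card (ιG → Option α) := Nat.card_pos
    rw [hB]; exact_mod_cast this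
  set γ₁ : ℝ := γ / (2 * B) with hγ₁
  have hγ₁0 : 0 < γ₁ := by positivity
  obtain ⟨ιL, hιL, hupL⟩ := up γ₁ hγ₁0
  obtain ⟨A, hA, hAl⟩ := low γ₁ hγ₁0 (ιG ⊕ ιL) inferInstance
  -- all fibres have almost the right density
  have hfib : ∀ x : ιG → Option α, δ - γ ≤ EE fun y : ιL → Option α => ind (A (Sum.elim x y)) := by
    rw [EE_sumType] at hA
    have h1 : ∀ x : ιG → Option α,
        (EE fun y : ιL → Option α => ind (A (Sum.elim x y))) ≤ δ + γ₁ := by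
      intro x
      apply hupL
      intro hl
      apply hAl
      refine HasLine.of_sub (V := padL x Sum.inr) (Proper.padL (fun e => ⟨e, rfl⟩) x) ?_
      simp only [sub_padL]
      exact hl
    intro x
    have h2 := le_of_EE_ge h1 (t := 2 * γ₁) (by linarith) x
    rw [← hB] at h2
    have : 2 * γ₁ * B = γ := by rw [hγ₁]; field_simp
    linarith
  rcases hGR (fun _ x => θ ≤ EE fun y : ιL → Option α => ind (∀ a, A (Sum.elim (rr a x) y))) with
    ⟨_, V, hV, ⟨i₀, hi₀⟩, hG⟩ | ⟨U, hU, hUn, hUb⟩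
  · -- good case: density increment
    have hmain : ∀ y : ιL → Option α,
        (EE fun x : ζ → Option α => (ind (A (Sum.elim (sub V x) y)) - (δ + γ)) *
          ind (¬ ∀ a, A (Sum.elim (rr a (sub V x)) y))) ≤ δ * θ / 4 := by
      intro y
      have h1 := hcor (fun a x => A (Sum.elim (rr a (sub V x)) y)) (fun a x => by
          simp only [rr_sub_rr]) (fun x => ind (A (Sum.elim (sub V x) y)) - (δ + γ))
        (fun x => by linarith [ind_le_one (A (Sum.elim (sub V x) y))]) (fun W hW => by
          rw [EE_sub, EE_const]
          have h2 := hup (fun x => A (Sum.elim (sub V (sub W x)) y)) (fun hl => hAl (by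
            refine HasLine.of_sub (V := padR (comp V W) y) ((hV.comp hW).padR y) ?_
            simpa only [sub_padR, sub_comp] using hl))
          linarith)
      refine h1.trans (le_of_eq ?_)
      rw [← hk]
      field_simp
    have hpt : ∀ (x : ζ → Option α) (y : ιL → Option α),
        (ind (A (Sum.elim (sub V x) y)) - (δ + γ)) * ind (¬ ∀ a, A (Sum.elim (rr a (sub V x)) y)) =
        ind (A (Sum.elim (sub V x) y)) -
          (δ + γ) * (1 - ind (∀ a, A (Sum.elim (rr a (sub V x)) y))) := by
      intro x y
      by_cases h1 : ∀ a, A (Sum.elim (rr a (sub V x)) y)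
      · have h2 : ¬ A (Sum.elim (sub V x) y) := by
          intro h2
          apply hAl
          refine ⟨Sum.elim (fun i => (sub V x i).map some) (fun j => some (y j)),
            ⟨Sum.inl i₀, by simp [sub, hi₀]⟩, fun a => ?_⟩
          cases a with
          | none =>
            convert h2 using 1
            funext i
            rcases i with i | i
            · simp only [Sum.elim_inl]
              cases sub V x i <;> rfl
            · rfl
          | some a =>
            convert h1 a using 1
            funext i
            rcases i with i | i
            · simp only [Sum.elim_inl, rr]
              cases sub V x i <;> rfl
            · rfl
        rw [ind_false h2, ind_true h1, ind_false (not_not.2 h1)]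
        ring
      · rw [ind_false h1, ind_true h1]; ring
    have h1 : (EE fun y : ιL → Option α => EE fun x : ζ → Option α =>
        ind (A (Sum.elim (sub V x) y)) -
          (δ + γ) * (1 - ind (∀ a, A (Sum.elim (rr a (sub V x)) y)))) ≤ δ * θ / 4 := by
      refine EE_le fun y => ?_
      rw [← EE_congr fun x => hpt x y]
      exact hmain y
    rw [EE_comm] at h1
    have h2 : (δ - γ) - (δ + γ) * (1 - θ) ≤ EE fun x : ζ → Option α => EE fun y : ιL → Option α =>
        ind (A (Sum.elim (sub V x) y)) -
          (δ + γ) * (1 - ind (∀ a, A (Sum.elim (rr a (sub V x)) y))) := by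
      refine le_EE fun x => ?_
      rw [EE_sub, EE_mul_left, EE_sub, EE_const]
      have h3 := hfib (sub V x)
      have h4 := hG x
      nlinarith
    have : 0 < δ * θ := by positivity
    nlinarith
  · -- bad case: contradiction with DHJ for the smaller alphabet
    have hE : δ / 2 ≤ EE fun y : ιL → Option α => EE fun u : ι₀ → α =>
        ind (A (Sum.elim (sub U fun e => some (u e)) y)) := by
      rw [EE_comm]
      refine le_EE fun u => ?_
      have := hfib (sub U fun e => some (u e))
      have : γ ≤ δ / 8 := by rw [hγ]; nlinarith
      linarith
    obtain ⟨l, hl⟩ := pop (L := ι₀ → Option α) (τ := δ / 4) (by positivity)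
      (fun y => EE_le fun u => ind_le_one _) (by linarith)
      (fun (y : ιL → Option α) l => (∃ i, l i = none) ∧
        ∀ a, A (Sum.elim (sub U fun e => some ((l e).getD a)) y))
      (fun y hy => h₀ (fun u => A (Sum.elim (sub U fun e => some (u e)) y)) hy)
    rw [← hL, ← hθ] at hl
    have hnone : ∃ i, l i = none := by
      obtain ⟨y, hy⟩ := exists_EE_le (fun y : ιL → Option α => ind ((∃ i, l i = none) ∧
        ∀ a, A (Sum.elim (sub U fun e => some ((l e).getD a)) y)))
      exact (of_ind_pos (lt_of_lt_of_le hθ0 (hl.trans hy))).1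
    refine hUb () l hnone (hl.trans (EE_mono fun y => ind_mono fun h a => ?_))
    convert h.2 a using 2
    funext i
    have := hUn i
    simp only [rr, sub]
    rcases hi : U i with (_ | c) | c
    · exact absurd hi this
    · rfl
    · rfl

lemma DHJ_equiv {α β : Type} [Finite α] [Finite β] (e : α ≃ β) (H : DHJ α) : DHJ β := by
  intro δ hδ
  obtain ⟨ι, hι, h⟩ := H δ hδ
  refine ⟨ι, hι, fun A hA => ?_⟩
  have e1 := EE_equiv (Equiv.arrowCongr (Equiv.refl ι) e) (fun x => ind (A x))
  rw [← e1] at hA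
  obtain ⟨L, ⟨i, hi⟩, hL⟩ := h (fun x => A (fun i => e (x i))) hA
  refine ⟨fun i => (L i).map e, ⟨i, by simp [hi]⟩, fun b => ?_⟩
  convert hL (e.symm b) using 1
  funext i
  cases hLi : L i <;> simp [hLi]

lemma DHJ_unit : DHJ Unit := by
  intro δ hδ
  refine ⟨Unit, inferInstance, fun A hA => ?_⟩
  obtain ⟨x, hx⟩ := exists_EE_le (fun x => ind (A x))
  have : A x := of_ind_pos (by linarith)
  exact ⟨fun _ => none, ⟨(), rfl⟩, fun a => this⟩

/-- The density Hales-Jewett theorem. -/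
theorem DHJ_fin (k : ℕ) : DHJ (Fin (k + 1)) := by
  induction k with
  | zero => exact DHJ_equiv (Equiv.ofUnique Unit (Fin 1)) DHJ_unit
  | succ k IH => exact DHJ_equiv (finSuccEquiv (k + 1)).symm (DHJ_option IH)

end NLog


namespace NLog

/-- The function `x log x`. -/
noncomputable def ff (x : ℝ) : ℝ := x * Real.log x

lemma ff_upper {x y : ℝ} (hx : 0 < x) (hxy : x ≤ y) : ff y - ff x ≤ (y - x) * (Real.log y + 1) := by
  have hy : 0 < y := hx.trans_le hxy
  have h := Real.log_le_sub_one_of_pos (div_pos hy hx)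
  rw [Real.log_div hy.ne' hx.ne'] at h
  have h2 : x * (Real.log y - Real.log x) ≤ x * (y / x - 1) := mul_le_mul_of_nonneg_left h hx.le
  have h3 : x * (y / x - 1) = y - x := by field_simp
  unfold ff
  linarith

lemma ff_lower {x y : ℝ} (hx : 0 < x) (hxy : x ≤ y) : (y - x) * (Real.log x + 1) ≤ ff y - ff x := by
  have hy : 0 < y := hx.trans_le hxy
  have h := Real.log_le_sub_one_of_pos (div_pos hx hy)
  rw [Real.log_div hx.ne' hy.ne'] at h
  have h2 : y * (Real.log x - Real.log y) ≤ y * (x / y - 1) := mul_le_mul_of_nonneg_left h hy.le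
  have h3 : y * (x / y - 1) = x - y := by field_simp
  unfold ff
  linarith

/-- Long arithmetic progressions of step `q` among the values. -/
lemma lemK (q K : ℕ) (hq : 3 ≤ q) (hK : (2 * K + 1) ^ 2 ≤ 2 ^ (q - 1)) :
    ∃ c : ℕ, 1 ≤ c ∧ c + q * K ≤ 2 ^ (3 * q) ∧
      ∀ k ≤ K, ∃ n : ℕ, 1 ≤ n ∧ ⌊ff n⌋ = ((c + q * k : ℕ) : ℤ) := by
  set E : ℝ := Real.exp ((q : ℝ) - 1) with hE
  have hE0 : 0 < E := Real.exp_pos _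
  have he2 : (2 : ℝ) ≤ Real.exp 1 := by linarith [Real.exp_one_gt_d9]
  have he3 : Real.exp 1 ≤ 2.72 := by linarith [Real.exp_one_lt_d9]
  have hEpow : E = Real.exp 1 ^ (q - 1) := by
    rw [hE, ← Real.exp_nat_mul, Nat.cast_sub (by omega)]; simp
  have hKE : ((2 * K + 1 : ℝ)) ^ 2 ≤ E := by
    have h1 : ((2 * K + 1 : ℝ)) ^ 2 ≤ 2 ^ (q - 1) := by exact_mod_cast hK
    exact h1.trans (hEpow ▸ pow_le_pow_left₀ (by norm_num) he2 _)
  have hE4 : 4 ≤ E := by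
    rw [hEpow]
    calc (4 : ℝ) = 2 ^ 2 := by norm_num
      _ ≤ 2 ^ (q - 1) := pow_le_pow_right₀ (by norm_num) (by omega)
      _ ≤ _ := pow_le_pow_left₀ (by norm_num) he2 _
  set N : ℕ := ⌈E⌉₊ with hN
  have hN1 : E ≤ N := Nat.le_ceil _
  have hN2 : (N : ℝ) < E + 1 := Nat.ceil_lt_add_one hE0.le
  have hN0 : (0 : ℝ) < N := hE0.trans_le hN1
  set v : ℕ → ℝ := fun n => ff n - q * n with hv
  have hlogE : Real.log E = q - 1 := by rw [hE, Real.log_exp]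
  have hmono : ∀ a b : ℕ, N ≤ a → a ≤ b → v a ≤ v b := by
    intro a b ha hab
    have ha' : (N : ℝ) ≤ a := by exact_mod_cast ha
    have hab' : (a : ℝ) ≤ b := by exact_mod_cast hab
    have h1 := ff_lower (hN0.trans_le ha') hab'
    have h2 : (q : ℝ) - 1 ≤ Real.log a := by
      rw [← hlogE]; exact Real.log_le_log hE0 (hN1.trans ha')
    simp only [hv]
    nlinarith
  have hvar : v (N + 2 * K) - v N < 1 := by
    have h1 := ff_upper hN0 (show (N : ℝ) ≤ ((N + 2 * K : ℕ) : ℝ) by push_cast; linarith [(Nat.cast_nonneg K : (0:ℝ) ≤ K)])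
    have hK0 : (0 : ℝ) ≤ K := Nat.cast_nonneg K
    have h2 : Real.log ((N + 2 * K : ℕ) : ℝ) ≤ q - 1 + (2 * K + 1) / E := by
      have h3 : Real.log ((N + 2 * K : ℕ) : ℝ) ≤ Real.log (E * (1 + (2 * K + 1) / E)) := by
        apply Real.log_le_log
        · push_cast; linarith
        · push_cast
          have : E * (1 + (2 * K + 1) / E) = E + (2 * K + 1) := by field_simp
          linarith
      rw [Real.log_mul hE0.ne' (by positivity), hlogE] at h3
      have h4 := Real.log_le_sub_one_of_pos (show 0 < 1 + (2 * (K : ℝ) + 1) / E by positivity)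
      linarith
    have h5 : v (N + 2 * K) - v N ≤ 2 * K * ((2 * K + 1) / E) := by
      simp only [hv]
      push_cast at h1 h2 ⊢
      nlinarith
    have h6 : 2 * K * ((2 * K + 1) / E) < 1 := by
      rw [← mul_div_assoc, div_lt_one hE0]
      nlinarith
    linarith
  have hfl : ∀ n : ℕ, ⌊ff n⌋ = ⌊v n⌋ + q * n := by
    intro n
    have : ff n = v n + ((q * n : ℕ) : ℤ) := by simp [hv]
    rw [this, Int.floor_add_intCast]; push_cast; rfl
  have hex : ∃ N' : ℕ, N ≤ N' ∧ N' ≤ N + K ∧ ∀ k ≤ K, ⌊v (N' + k)⌋ = ⌊v N'⌋ := by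
    have m1 := Int.floor_mono (hmono N (N + K) le_rfl (by omega))
    have m2 := Int.floor_mono (hmono (N + K) (N + 2 * K) (by omega) (by omega))
    have m3 : ⌊v (N + 2 * K)⌋ ≤ ⌊v N⌋ + 1 := by
      rw [← Int.floor_add_one]; exact Int.floor_mono (by linarith)
    by_cases hc : ⌊v (N + K)⌋ = ⌊v N⌋
    · refine ⟨N, le_rfl, by omega, fun k hk => ?_⟩
      have a1 := Int.floor_mono (hmono N (N + k) le_rfl (by omega))
      have a2 := Int.floor_mono (hmono (N + k) (N + K) (by omega) (by omega))
      omega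
    · refine ⟨N + K, by omega, by omega, fun k hk => ?_⟩
      have a1 := Int.floor_mono (hmono (N + K) (N + K + k) (by omega) (by omega))
      have a2 := Int.floor_mono (hmono (N + K + k) (N + 2 * K) (by omega) (by omega))
      omega
  obtain ⟨N', hN'1, hN'2, hk⟩ := hex
  have hN'r : (N : ℝ) ≤ N' := by exact_mod_cast hN'1
  have hlog1 : ∀ n : ℕ, N ≤ n → 1 ≤ ff n := by
    intro n hn
    have hn' : (N : ℝ) ≤ n := by exact_mod_cast hn
    have h2 : (q : ℝ) - 1 ≤ Real.log n := by
      rw [← hlogE]; exact Real.log_le_log hE0 (hN1.trans hn')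
    have : (3 : ℝ) ≤ q := by exact_mod_cast hq
    unfold ff
    nlinarith
  have hc1 : 1 ≤ ⌊ff N'⌋ := Int.le_floor.2 (by simpa using hlog1 N' hN'1)
  have hkk : ∀ k ≤ K, ⌊ff ((N' + k : ℕ) : ℝ)⌋ = ((⌊ff N'⌋.toNat + q * k : ℕ) : ℤ) := by
    intro k hk'
    rw [hfl, hk k hk']
    have := hfl N'
    push_cast
    rw [Int.toNat_of_nonneg (by omega), this]
    ring
  refine ⟨⌊ff N'⌋.toNat, by omega, ?_, fun k hk' => ⟨N' + k, ?_, hkk k hk'⟩⟩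
  · have h1 := hkk K le_rfl
    have h2 : ((⌊ff ((N' + K : ℕ) : ℝ)⌋ : ℤ) : ℝ) ≤ ff ((N' + K : ℕ) : ℝ) := Int.floor_le _
    rw [h1] at h2
    set M : ℝ := ((N' + K : ℕ) : ℝ) with hM
    have hM1 : M ≤ 2 * E := by
      have : M ≤ N + 2 * K := by rw [hM]; exact_mod_cast (by omega : N' + K ≤ N + 2 * K)
      have hK0 : (0 : ℝ) ≤ K := Nat.cast_nonneg K
      nlinarith
    have hM0 : 0 < M := by
      rw [hM]; push_cast; linarith [(Nat.cast_nonneg K : (0:ℝ) ≤ K)]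
    have h3 : ff M ≤ M * M := by
      unfold ff
      have := Real.log_le_sub_one_of_pos hM0
      nlinarith
    have h4 : M * M ≤ 2 ^ (3 * q) := by
      have h5 : 2 * E ≤ Real.exp 1 ^ q := by
        have : q = (q - 1) + 1 := by omega
        rw [this, pow_succ, ← hEpow]
        nlinarith
      calc M * M ≤ Real.exp 1 ^ q * Real.exp 1 ^ q := by
            apply mul_le_mul (hM1.trans h5) (hM1.trans h5) hM0.le (by positivity)
        _ = (Real.exp 1 ^ 2) ^ q := by rw [← pow_mul, ← pow_add]; congr 1; ring
        _ ≤ (2 ^ 3) ^ q := pow_le_pow_left₀ (by positivity) (by nlinarith) _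
        _ = _ := by rw [← pow_mul]
    have h6 := (h2.trans h3).trans h4
    exact_mod_cast h6
  · have : 0 < N := by exact_mod_cast hN0
    omega

lemma poly_exp (r : ℕ) : ∃ P₀ : ℕ, ∀ p ≥ P₀, (32 ^ r * p) ^ r ≤ 2 ^ (p / 4 - 1) := by
  have h := tendsto_pow_const_div_const_pow_of_one_lt r (show (1 : ℝ) < 2 by norm_num)
  set C : ℕ := 2 * (32 ^ r * 8) ^ r with hC
  have hC0 : (0 : ℝ) < C := by positivity
  have h1 := h.eventually (gt_mem_nhds (show (0 : ℝ) < 1 / C by positivity))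
  obtain ⟨M, hM⟩ := Filter.eventually_atTop.1 h1
  refine ⟨4 * M + 8, fun p hp => ?_⟩
  have h2 := hM (p / 4) (by omega)
  rw [div_lt_div_iff₀ (by positivity) hC0, one_mul] at h2
  have h3 : (p / 4) ^ r * C < 2 ^ (p / 4) := by exact_mod_cast h2
  have h4 : (32 ^ r * p) ^ r ≤ (32 ^ r * 8) ^ r * (p / 4) ^ r := by
    rw [← mul_pow, mul_assoc]
    exact Nat.pow_le_pow_left (Nat.mul_le_mul_left _ (by omega)) _
  have h5 : 2 ^ (p / 4) = 2 * 2 ^ (p / 4 - 1) := by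
    rw [← pow_succ']; congr 1; omega
  rw [h5, hC] at h3
  nlinarith

/-- Finite sums sets among the values. -/
theorem FS (r : ℕ) : ∃ x : ℕ → ℕ, ∀ S : Finset ℕ, S ⊆ Finset.range r → S.Nonempty →
    0 < ∑ i ∈ S, x i ∧ ∃ n : ℕ, 1 ≤ n ∧ ⌊ff n⌋ = ((∑ i ∈ S, x i : ℕ) : ℤ) := by
  obtain ⟨P₀, hP₀⟩ := poly_exp r
  obtain ⟨p₀, hp₀1, hp₀⟩ := Nat.exists_infinite_primes (P₀ + 2 * r + 20)
  have hstep : ∀ p : ℕ, ∃ p', 0 < p → p'.Prime ∧ 16 * p < p' ∧ p' ≤ 32 * p := by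
    intro p
    by_cases hp : 0 < p
    · obtain ⟨p', h1, h2, h3⟩ := Nat.exists_prime_lt_and_le_two_mul (16 * p) (by omega)
      exact ⟨p', fun _ => ⟨h1, h2, by omega⟩⟩
    · exact ⟨0, fun h => absurd h hp⟩
  choose nx hnx using hstep
  set p : ℕ → ℕ := fun i => nx^[i] p₀ with hp
  have hps : ∀ i, p (i + 1) = nx (p i) := fun i => Function.iterate_succ_apply' nx i p₀
  have hprime : ∀ i, (p i).Prime := by
    intro i
    induction i with
    | zero => exact hp₀
    | succ i IH => rw [hps]; exact (hnx _ IH.pos).1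
  have hlt : ∀ i, 16 * p i < p (i + 1) := fun i => by rw [hps]; exact (hnx _ (hprime i).pos).2.1
  have hle : ∀ i, p (i + 1) ≤ 32 * p i := fun i => by rw [hps]; exact (hnx _ (hprime i).pos).2.2
  have hmono : StrictMono p := strictMono_nat_of_lt_succ fun i => by have := hlt i; omega
  have hbig : ∀ i, P₀ + 2 * r + 20 ≤ p i := fun i => hp₀1.trans (hmono.monotone (Nat.zero_le i))
  have hle2 : ∀ i d, p (i + d) ≤ 32 ^ d * p i := by
    intro i d
    induction d with
    | zero => simp
    | succ d IH =>
      have := hle (i + d)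
      rw [pow_succ, ← add_assoc]
      nlinarith
  set Q : ℕ → ℕ := fun i => ∏ j ∈ Finset.Ico (i + 1) r, p j with hQ
  have hQle : ∀ i, Q i ≤ 2 ^ (p i / 4 - 1) := by
    intro i
    refine le_trans ?_ (hP₀ (p i) (by have := hbig i; omega))
    calc Q i ≤ ∏ j ∈ Finset.Ico (i + 1) r, (32 ^ r * p i) := by
          refine Finset.prod_le_prod' fun j hj => ?_
          rw [Finset.mem_Ico] at hj
          obtain ⟨d, rfl⟩ : ∃ d, j = i + d := ⟨j - i, by omega⟩
          refine (hle2 i d).trans (Nat.mul_le_mul_right _ ?_)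
          exact Nat.pow_le_pow_right (by norm_num) (by omega)
      _ = (32 ^ r * p i) ^ (r - (i + 1)) := by simp
      _ ≤ _ := Nat.pow_le_pow_right (Nat.mul_pos (by positivity) (hprime i).pos) (by omega)
  have hQ0 : ∀ i, 0 < Q i := fun i => Finset.prod_pos fun j _ => (hprime j).pos
  have hcop : ∀ i, (p i).Coprime (Q i) := by
    intro i
    refine Nat.Coprime.prod_right fun j hj => ?_
    rw [Finset.mem_Ico] at hj
    exact (Nat.coprime_primes (hprime i) (hprime j)).2 (hmono (show i < j by omega)).ne
  have hK : ∀ i, ∃ c : ℕ, 1 ≤ c ∧ c + p i * 2 ^ (p i / 4) ≤ 2 ^ (3 * p i) ∧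
      ∀ k ≤ 2 ^ (p i / 4), ∃ n : ℕ, 1 ≤ n ∧ ⌊ff n⌋ = ((c + p i * k : ℕ) : ℤ) := by
    intro i
    have hb := hbig i
    refine lemK _ _ (by omega) ?_
    have h1 : 1 ≤ 2 ^ (p i / 4) := Nat.one_le_two_pow
    calc (2 * 2 ^ (p i / 4) + 1) ^ 2 ≤ (4 * 2 ^ (p i / 4)) ^ 2 := Nat.pow_le_pow_left (by omega) 2
      _ = 2 ^ (4 + 2 * (p i / 4)) := by rw [pow_add, pow_mul', mul_pow]; norm_num
      _ ≤ _ := Nat.pow_le_pow_right (by norm_num) (by omega)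
  choose c hc1 hcle hc using hK
  have hk : ∀ i, ∃ k, k < Q i ∧ Q i ∣ c i + p i * k := by
    intro i
    have : NeZero (Q i) := ⟨(hQ0 i).ne'⟩
    refine ⟨(-(c i : ZMod (Q i)) * (p i : ZMod (Q i))⁻¹).val, ZMod.val_lt _, ?_⟩
    rw [← ZMod.natCast_eq_zero_iff]
    push_cast
    rw [ZMod.natCast_zmod_val, mul_comm (-(c i : ZMod (Q i))), ← mul_assoc,
      ZMod.coe_mul_inv_eq_one _ (hcop i)]
    ring
  choose k hkQ hkd using hk
  set x : ℕ → ℕ := fun i => c i + p i * k i with hx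
  have hhalf : ∀ i, 2 ^ (p i / 4) = 2 * 2 ^ (p i / 4 - 1) := by
    intro i
    have := hbig i
    rw [← pow_succ']; congr 1; omega
  have hxle : ∀ i, x i ≤ 2 ^ (3 * p i) := by
    intro i
    refine le_trans ?_ (hcle i)
    have : k i ≤ 2 ^ (p i / 4) := by have := hkQ i; have := hQle i; have := hhalf i; omega
    exact Nat.add_le_add_left (Nat.mul_le_mul_left _ this) _
  have hxd : ∀ i j, i < j → j < r → p j ∣ x i := fun i j hij hj =>
    (Finset.dvd_prod_of_mem p (Finset.mem_Ico.2 ⟨hij, hj⟩)).trans (hkd i)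
  refine ⟨x, fun S hS hne => ?_⟩
  have hxpos : ∀ i, 0 < x i := fun i => by have := hc1 i; simp only [hx]; omega
  refine ⟨Finset.sum_pos (fun i _ => hxpos i) hne, ?_⟩
  set i := S.max' hne with hi
  have hiS : i ∈ S := S.max'_mem hne
  have hir : i < r := Finset.mem_range.1 (hS hiS)
  have hlti : ∀ j ∈ S.erase i, j < i := by
    intro j hj
    rw [Finset.mem_erase] at hj
    exact lt_of_le_of_ne (S.le_max' j hj.2) hj.1
  rw [← Finset.add_sum_erase S x hiS]
  obtain ⟨s, hs⟩ : p i ∣ ∑ j ∈ S.erase i, x j :=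
    Finset.dvd_sum fun j hj => hxd j i (hlti j hj) hir
  rw [hs]
  have hsle : s ≤ 2 ^ (p i / 4 - 1) := by
    have h1 : s ≤ ∑ j ∈ S.erase i, x j := by
      rw [hs]; exact Nat.le_mul_of_pos_left _ (hprime i).pos
    rcases Nat.eq_zero_or_pos i with h0 | h0
    · have : S.erase i = ∅ := Finset.eq_empty_of_forall_notMem fun j hj => by
        have := hlti j hj; omega
      rw [this, Finset.sum_empty] at h1
      exact h1.trans (Nat.zero_le _)
    · obtain ⟨i', hi'⟩ : ∃ i', i = i' + 1 := ⟨i - 1, by omega⟩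
      have h2 : ∑ j ∈ S.erase i, x j ≤ r * 2 ^ (3 * p i') := by
        calc ∑ j ∈ S.erase i, x j ≤ ∑ j ∈ S.erase i, 2 ^ (3 * p i') := by
              refine Finset.sum_le_sum fun j hj => (hxle j).trans ?_
              refine Nat.pow_le_pow_right (by norm_num) (Nat.mul_le_mul_left _ ?_)
              exact hmono.monotone (by have := hlti j hj; omega)
          _ = (S.erase i).card * 2 ^ (3 * p i') := by simp
          _ ≤ _ := by
              refine Nat.mul_le_mul_right _ ?_
              calc (S.erase i).card ≤ S.card := Finset.card_le_card (Finset.erase_subset _ _)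
                _ ≤ (Finset.range r).card := Finset.card_le_card hS
                _ = r := Finset.card_range r
      have h3 := hlt i'
      rw [← hi'] at h3
      have hb := hbig i'
      have h4 : r ≤ 2 ^ r := Nat.lt_two_pow_self.le
      calc s ≤ r * 2 ^ (3 * p i') := h1.trans h2
        _ ≤ 2 ^ r * 2 ^ (3 * p i') := Nat.mul_le_mul_right _ h4
        _ = 2 ^ (r + 3 * p i') := by rw [pow_add]
        _ ≤ _ := Nat.pow_le_pow_right (by norm_num) (by omega)
  obtain ⟨n, hn1, hn⟩ := hc i (k i + s) (by
    have := hkQ i; have := hQle i; have := hhalf i; omega)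
  refine ⟨n, hn1, ?_⟩
  rw [hn, mul_add, ← add_assoc]

end NLog
namespace NLog

lemma EE_ind_ge {X : Type*} [Finite X] (P : X → Prop) (n : ℕ)
    (h : n ≤ Nat.card {x // P x}) : (n : ℝ) / (Nat.card X : ℝ) ≤ EE fun x => ind (P x) := by
  classical
  have := Fintype.ofFinite X
  rw [EE_eq]
  gcongr
  have h2 : ∑ x : X, ind (P x) = (Nat.card {x // P x} : ℝ) := by
    simp only [ind]
    rw [Nat.card_eq_fintype_card, Fintype.card_subtype, Finset.card_filter]
    push_cast
    exact Finset.sum_congr rfl fun x _ => by split_ifs <;> rfl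
  rw [h2]
  exact_mod_cast h

/-- The key deduction: density of translates of a finite configuration. -/
lemma exists_translate {W : Type*} [Finite W] [Nonempty W] (Λ : Set ℤ) (hΛ : 0 < upperDensity Λ)
    (d : W → ℕ) : ∃ m : ℤ, upperDensity Λ / 4 ≤ EE fun w => ind (m + (d w : ℤ) ∈ Λ) := by
  obtain ⟨H, hH⟩ : ∃ H, ∀ w, d w ≤ H := by
    obtain ⟨w, hw⟩ := Finite.exists_max d
    exact ⟨d w, hw⟩
  set δ := upperDensity Λ with hδ
  have hfr : ∃ᶠ N : ℕ in atTop, δ / 2 <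
      (Nat.card ↥(Λ ∩ Set.Icc (-(N : ℤ)) (N : ℤ)) : ℝ) / (2 * N + 1) := by
    refine frequently_lt_of_lt_limsup ?_ ?_
    · exact IsBoundedUnder.isCoboundedUnder_le ⟨0, by
        simp only [eventually_map]
        exact Eventually.of_forall fun N => by positivity⟩
    · show δ / 2 < δ
      linarith
  obtain ⟨N, hN, hNd⟩ := (hfr.and_eventually (eventually_ge_atTop H)).exists
  rw [lt_div_iff₀ (by positivity)] at hN
  let X := ↥(Finset.Icc (-(N : ℤ) - H) (N : ℤ))
  have hcard : Nat.card X = 2 * N + 1 + H := by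
    show Nat.card ↥(Finset.Icc (-(N : ℤ) - H) (N : ℤ)) = _
    rw [Nat.card_eq_fintype_card, Fintype.card_coe, Int.card_Icc]
    omega
  have hX : Nonempty X := ⟨⟨0, by rw [Finset.mem_Icc]; omega⟩⟩
  have key : δ / 4 ≤ EE fun m : X => EE fun w => ind ((m : ℤ) + (d w : ℤ) ∈ Λ) := by
    rw [EE_comm]
    refine le_EE fun w => ?_
    refine le_trans ?_ (EE_ind_ge (fun m : X => (m : ℤ) + (d w : ℤ) ∈ Λ)
      (Nat.card ↥(Λ ∩ Set.Icc (-(N : ℤ)) (N : ℤ))) ?_)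
    · rw [hcard, le_div_iff₀ (by positivity)]
      push_cast
      have : (H : ℝ) ≤ N := by exact_mod_cast hNd
      nlinarith
    · refine Nat.card_le_card_of_injective
        (fun a => ⟨⟨(a : ℤ) - d w, ?_⟩, ?_⟩) ?_
      · have h1 := a.2.2.1
        have h2 := a.2.2.2
        have := hH w
        rw [Finset.mem_Icc]
        omega
      · show (a : ℤ) - d w + d w ∈ Λ
        rw [sub_add_cancel]
        exact a.2.1
      · intro a b hab
        have h1 : (a : ℤ) - d w = (b : ℤ) - d w := congrArg (fun z => ((z.1 : X) : ℤ)) hab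
        exact Subtype.ext (by linarith)
  obtain ⟨m, hm⟩ := exists_EE_le (fun m : X => EE fun w => ind ((m : ℤ) + (d w : ℤ) ∈ Λ))
  exact ⟨m, key.trans hm⟩

end NLog

/-- The instance `a(x) = x·log x` of the paper's main theorem (Theorem A). -/
theorem stmt_19 (ℓ : ℕ) (hℓ : 1 ≤ ℓ) (Λ : Set ℤ) (hΛ : 0 < upperDensity Λ) :
    ∃ m : ℤ, ∃ n : ℕ, 1 ≤ n ∧ ⌊(n : ℝ) * Real.log n⌋ ≠ 0 ∧
      ∀ j : ℕ, j ≤ ℓ → m + (j : ℤ) * ⌊(n : ℝ) * Real.log n⌋ ∈ Λ := by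
  classical
  obtain ⟨ι, hι, h⟩ := NLog.DHJ_fin ℓ (upperDensity Λ / 4) (by positivity)
  have := Fintype.ofFinite ι
  obtain ⟨x, hx⟩ := NLog.FS (Fintype.card ι)
  let e : ι ↪ ℕ := (Fintype.equivFin ι).toEmbedding.trans Fin.valEmbedding
  obtain ⟨m, hm⟩ := NLog.exists_translate Λ hΛ
    (fun w : ι → Fin (ℓ + 1) => ∑ i, (w i : ℕ) * x (e i))
  obtain ⟨L, ⟨i₀, hi₀⟩, hL⟩ := h _ hm
  set S : Finset ι := Finset.univ.filter fun i => L i = none with hS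
  obtain ⟨hpos, n, hn1, hn⟩ := hx (S.map e) (by
    intro j hj
    obtain ⟨i, _, rfl⟩ := Finset.mem_map.1 hj
    simp [e]) ⟨e i₀, Finset.mem_map_of_mem e (by simp [hS, hi₀])⟩
  rw [NLog.ff] at hn
  refine ⟨m + ((∑ i, ((L i).getD 0 : ℕ) * x (e i) : ℕ) : ℤ), n, hn1, ?_, fun j hj => ?_⟩
  · rw [hn]; exact_mod_cast hpos.ne'
  · rw [hn]
    have h1 := hL (Fin.ofNat (ℓ + 1) j)
    convert h1 using 1
    rw [add_assoc]
    congr 1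
    rw [Finset.sum_map, hS, Finset.sum_filter]
    norm_cast
    rw [Finset.mul_sum, ← Finset.sum_add_distrib]
    refine Finset.sum_congr rfl fun i _ => ?_
    cases hLi : L i with
    | none => simp [hLi, Nat.mod_eq_of_lt (Nat.lt_succ_of_le hj)]
    | some a => simp [hLi]
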